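/- Let n ≥ 3 be an integer. The image γ(T(n)) = { γ(i,j,k) : (i,j,k) ∈ T(n) } consists of exactly (n^5 − 2n^3 + n^2)/2 distinct pairs, and each such pair lies in G(n) × G(n), where G(n) = ℕ \ S(n) is the gap set of S(n). (This image is the minimal generating set Γ(P₀,P∞) of the Weierstrass semigroup H(P₀,P∞) of the GK curve.) -/

import Mathlib

/-- Membership condition for the index set `T(n)` of triples `(i,j,k)` indexing the
functions `y^i z^j / x^k` on the GK curve. -/
def memT (n i j k : ℤ) : Prop :=
  0 ≤ i ∧ i ≤ n ∧ 0 ≤ j ∧ j ≤ n ^ 2 - n ∧ 1 ≤ k ∧ k ≤ n ^ 2 - 1 ∧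
  (1 ≤ k ∧ k ≤ n - 1 →
    ((0 ≤ i ∧ i ≤ k ∧ k - i + 1 ≤ j ∧ j ≤ n ^ 2 - n) ∨
     (k + 1 ≤ i ∧ i ≤ n ∧ 0 ≤ j ∧ j ≤ n ^ 2 - n))) ∧
  (n ≤ k ∧ k ≤ n ^ 2 - n - 2 → k - i + 1 ≤ j ∧ j ≤ n ^ 2 - n) ∧
  (n ^ 2 - n - 1 ≤ k ∧ k ≤ n ^ 2 - 1 →
    (k - n ^ 2 + n + 1 ≤ i ∧ i ≤ n ∧ k - i + 1 ≤ j ∧ j ≤ n ^ 2 - n))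

/-- The set `T(n)` of triples `(i, j, k)`. -/
def T (n : ℤ) : Set (ℤ × ℤ × ℤ) := {x | memT n x.1 x.2.1 x.2.2}

/-- The map `γ(i,j,k) = (k(n^3+1) − i(n^2−n+1) − j, i(n^3−n^2+n) + j n^3 − k(n^3+1))`,
the pair of pole orders at `P₀` and `P∞` of `y^i z^j / x^k`. -/
def gammaMap (n : ℤ) (x : ℤ × ℤ × ℤ) : ℤ × ℤ :=
  (x.2.2 * (n ^ 3 + 1) - x.1 * (n ^ 2 - n + 1) - x.2.1,
   x.1 * (n ^ 3 - n ^ 2 + n) + x.2.1 * n ^ 3 - x.2.2 * (n ^ 3 + 1))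

/-- The gap set `G(n) = ℕ \ S(n)` (viewed inside `ℤ`) of the numerical semigroup `S(n)`
generated by `n^3 − n^2 + n`, `n^3` and `n^3 + 1`. -/
def Ggaps (n : ℤ) : Set ℤ :=
  {m | 0 ≤ m ∧ ¬ ∃ a b c : ℕ,
    m = (a : ℤ) * (n ^ 3 - n ^ 2 + n) + (b : ℤ) * n ^ 3 + (c : ℤ) * (n ^ 3 + 1)}

theorem memT_iff (n i j k : ℤ) (hn : 3 ≤ n) :
    memT n i j k ↔ 0 ≤ i ∧ i ≤ n ∧ 0 ≤ j ∧ j ≤ n ^ 2 - n ∧ 1 ≤ k ∧ k < i + j := by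
  have h : 3 * n ≤ n ^ 2 := by nlinarith
  unfold memT
  generalize n ^ 2 = m at *
  constructor
  · rintro ⟨h1, h2, h3, h4, h5, h6, h7, h8, h9⟩
    refine ⟨h1, h2, h3, h4, h5, ?_⟩
    by_cases c1 : k ≤ n - 1
    · rcases h7 ⟨h5, c1⟩ with h | h <;> omega
    · by_cases c2 : k ≤ m - n - 2
      · have := h8 ⟨by omega, c2⟩
        omega
      · have := h9 ⟨by omega, by omega⟩
        omega
  · rintro ⟨h1, h2, h3, h4, h5, h6⟩
    refine ⟨h1, h2, h3, h4, h5, by omega, fun h => ?_, fun h => ?_, fun h => ?_⟩ <;> omega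

/-- residues: if `x q + y = 0` with `y > -q` then `y = t q` with `t ≥ 0`. -/
theorem res_aux (q x y : ℤ) (hq : 0 < q) (h : y = x * q) (hy : -q < y) : 0 ≤ x := by
  by_contra hx
  have : x ≤ -1 := by omega
  nlinarith

theorem gap_aux (n i j k : ℤ) (hn : 3 ≤ n) (hi : 0 ≤ i) (hin : i ≤ n) (hj : 0 ≤ j)
    (hjn : j ≤ n ^ 2 - n) (hk : 1 ≤ k) (hkij : k < i + j) :
    k * (n ^ 3 + 1) - i * (n ^ 2 - n + 1) - j ∈ Ggaps n := by
  refine ⟨by nlinarith [mul_le_mul_of_nonneg_right hin (by nlinarith : 0 ≤ n ^ 2 - n + 1),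
    mul_le_mul_of_nonneg_right hk (by positivity : 0 ≤ n ^ 3 + 1)], ?_⟩
  rintro ⟨a, b, c, h⟩
  have ha : (0 : ℤ) ≤ a := by positivity
  have hb : (0 : ℤ) ≤ b := by positivity
  have hc : (0 : ℤ) ≤ c := by positivity
  generalize (a : ℤ) = a at *
  generalize (b : ℤ) = b at *
  generalize (c : ℤ) = c at *
  have hq : 0 < n ^ 2 - n + 1 := by nlinarith
  obtain ⟨t, ht⟩ : ∃ t, t = (a + b + c - k) * (n + 1) - a + i := ⟨_, rfl⟩
  have hbt : b - j = t * (n ^ 2 - n + 1) := by rw [ht]; linear_combination h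
  have ht0 : 0 ≤ t := res_aux _ _ _ hq hbt (by linarith)
  have hu : a + t - i = (a + b + c - k) * (n + 1) := by rw [ht]; ring
  have hu0 := res_aux _ _ _ (by linarith) hu (by linarith)
  nlinarith [mul_nonneg ht0 (by nlinarith : 0 ≤ n ^ 2 - n),
    mul_nonneg hu0 (by linarith : 0 ≤ n)]

theorem inj_aux (n i j k i' j' k' : ℤ) (hn : 3 ≤ n) (hi : 0 ≤ i) (hin : i ≤ n) (hj : 0 ≤ j)
    (hjn : j ≤ n ^ 2 - n) (hi' : 0 ≤ i') (hin' : i' ≤ n) (hj' : 0 ≤ j')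
    (hjn' : j' ≤ n ^ 2 - n)
    (h : k * (n ^ 3 + 1) - i * (n ^ 2 - n + 1) - j =
      k' * (n ^ 3 + 1) - i' * (n ^ 2 - n + 1) - j') : i = i' ∧ j = j' ∧ k = k' := by
  obtain ⟨t, ht⟩ : ∃ t, t = (k - k') * (n + 1) - (i - i') := ⟨_, rfl⟩
  have h1 : j - j' = t * (n ^ 2 - n + 1) := by rw [ht]; linear_combination -h
  have h2 : j' - j = (-t) * (n ^ 2 - n + 1) := by linear_combination -h1
  have a1 := res_aux _ _ _ (by nlinarith) h1 (by linarith)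
  have a2 := res_aux _ _ _ (by nlinarith) h2 (by linarith)
  have t0 : t = 0 := by omega
  have h3 : i - i' = (k - k') * (n + 1) := by linarith
  have h4 : i' - i = (k' - k) * (n + 1) := by linarith
  have a3 := res_aux _ _ _ (by nlinarith) h3 (by linarith)
  have a4 := res_aux _ _ _ (by nlinarith) h4 (by linarith)
  have k0 : k - k' = 0 := by omega
  rw [k0] at h3
  rw [t0] at h1
  refine ⟨by linarith, by linarith, by linarith⟩

theorem sum_lin (a b : ℕ) :
    2 * ∑ j ∈ Finset.range (b + 1), ((a + j : ℕ) : ℤ) = (b + 1) * (2 * a + b) := by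
  induction b with
  | zero => simp
  | succ b ih => rw [Finset.sum_range_succ, mul_add, ih]; push_cast; ring

theorem sum_zero (b : ℕ) :
    2 * ∑ j ∈ Finset.range (b + 1), ((0 + j - 1 : ℕ) : ℤ) = b * (b - 1) := by
  induction b with
  | zero => simp
  | succ b ih =>
    rw [Finset.sum_range_succ, mul_add, ih]
    have : 0 + (b + 1) - 1 = b := by omega
    rw [this]; push_cast; ring

theorem sum_all (a b : ℕ) :
    2 * ∑ i ∈ Finset.range (a + 1), ∑ j ∈ Finset.range (b + 1), ((i + j - 1 : ℕ) : ℤ) =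
      (a + 1) * (b + 1) * (a + b - 2) + 2 := by
  induction a with
  | zero =>
    rw [zero_add, Finset.sum_range_one, sum_zero]; push_cast; ring
  | succ a ih =>
    rw [Finset.sum_range_succ, mul_add, ih]
    have : ∀ j, a + 1 + j - 1 = a + j := by intro j; omega
    simp only [this]
    rw [sum_lin]; push_cast; ring

theorem ncard_aux (a b : ℕ) :
    2 * (({x | 0 ≤ x.1 ∧ x.1 ≤ (a : ℤ) ∧ 0 ≤ x.2.1 ∧ x.2.1 ≤ (b : ℤ) ∧ 1 ≤ x.2.2 ∧
      x.2.2 < x.1 + x.2.1} : Set (ℤ × ℤ × ℤ)).ncard : ℤ) =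
      (a + 1) * (b + 1) * (a + b - 2) + 2 := by
  let F : Finset (Σ _ : ℕ × ℕ, ℕ) :=
    (Finset.range (a + 1) ×ˢ Finset.range (b + 1)).sigma (fun p => Finset.Ioo 0 (p.1 + p.2))
  let f : (Σ _ : ℕ × ℕ, ℕ) → ℤ × ℤ × ℤ := fun x => (x.1.1, x.1.2, x.2)
  have hf : Function.Injective f := by
    rintro ⟨⟨i, j⟩, k⟩ ⟨⟨i', j'⟩, k'⟩ h
    simp only [f, Prod.mk.injEq, Nat.cast_inj] at h
    obtain ⟨rfl, rfl, rfl⟩ := h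
    rfl
  have : ({x | 0 ≤ x.1 ∧ x.1 ≤ (a : ℤ) ∧ 0 ≤ x.2.1 ∧ x.2.1 ≤ (b : ℤ) ∧ 1 ≤ x.2.2 ∧
      x.2.2 < x.1 + x.2.1} : Set (ℤ × ℤ × ℤ)) = f '' (F : Set (Σ _ : ℕ × ℕ, ℕ)) := by
    ext ⟨i, j, k⟩
    simp only [Set.mem_ofPred_eq, Set.mem_image, Finset.mem_coe]
    constructor
    · rintro ⟨h1, h2, h3, h4, h5, h6⟩
      refine ⟨⟨(i.toNat, j.toNat), k.toNat⟩, ?_, ?_⟩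
      · simp only [F, Finset.mem_sigma, Finset.mem_product, Finset.mem_range, Finset.mem_Ioo]
        omega
      · simp only [f, Prod.mk.injEq]
        omega
    · rintro ⟨⟨⟨i', j'⟩, k'⟩, h, h'⟩
      simp only [F, Finset.mem_sigma, Finset.mem_product, Finset.mem_range,
        Finset.mem_Ioo] at h
      simp only [f, Prod.mk.injEq] at h'
      omega
  rw [this, Set.ncard_image_of_injective _ hf, Set.ncard_coe_finset, Finset.card_sigma,
    Finset.sum_product, ← sum_all]
  simp only [Nat.card_Ioo, Nat.sub_zero]
  push_cast
  rfl

/-- for `n ≥ 3`, the image `γ(T(n))` consists of exactly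
`(n^5 − 2n^3 + n^2)/2` distinct pairs and lies in `G(n) × G(n)`. -/
theorem gamma_image (n : ℤ) (hn : 3 ≤ n) :
    ((gammaMap n '' T n).ncard : ℤ) = (n ^ 5 - 2 * n ^ 3 + n ^ 2) / 2 ∧
    gammaMap n '' T n ⊆ Ggaps n ×ˢ Ggaps n := by
  constructor
  · have hinj : Set.InjOn (gammaMap n) (T n) := by
      rintro ⟨i, j, k⟩ hx ⟨i', j', k'⟩ hy h
      obtain ⟨h1, h2, h3, h4, -, -⟩ := (memT_iff n i j k hn).1 hx
      obtain ⟨g1, g2, g3, g4, -, -⟩ := (memT_iff n i' j' k' hn).1 hy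
      obtain ⟨rfl, rfl, rfl⟩ := inj_aux n i j k i' j' k' hn h1 h2 h3 h4 g1 g2 g3 g4
        (congrArg Prod.fst h)
      rfl
    rw [hinj.ncard_image]
    obtain ⟨a, ha⟩ := Int.eq_ofNat_of_zero_le (by linarith : 0 ≤ n)
    obtain ⟨b, hb⟩ := Int.eq_ofNat_of_zero_le (by nlinarith : 0 ≤ n ^ 2 - n)
    have key := ncard_aux a b
    rw [← ha, ← hb] at key
    have hT : T n = {x | 0 ≤ x.1 ∧ x.1 ≤ n ∧ 0 ≤ x.2.1 ∧ x.2.1 ≤ n ^ 2 - n ∧ 1 ≤ x.2.2 ∧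
      x.2.2 < x.1 + x.2.1} := by
      ext ⟨i, j, k⟩
      exact memT_iff n i j k hn
    rw [← hT] at key
    have e : n ^ 5 - 2 * n ^ 3 + n ^ 2 = 2 * ((T n).ncard : ℤ) := by rw [key]; ring
    rw [e]
    omega
  · rintro _ ⟨⟨i, j, k⟩, hx, rfl⟩
    obtain ⟨h1, h2, h3, h4, h5, h6⟩ := (memT_iff n i j k hn).1 hx
    refine ⟨gap_aux n i j k hn h1 h2 h3 h4 h5 h6, ?_⟩
    have := gap_aux n i j (i + j - k) hn h1 h2 h3 h4 (by omega) (by omega)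
    convert this using 1
    simp only [gammaMap]
    ring
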